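/- Let 𝕂 be an ω-continuous commutative semiring, O^𝕂 a 𝕂-annotated ELHI⊥ ontology, C an ELHI concept, a ∈ N_I, and A_C a concept name occurring neither in O^𝕂 nor in C. Then P(A_C(a), O^𝕂 ∪ {(C ⊑ A_C, 1)}) = P(q_C(a), O^𝕂). -/

import Mathlib

namespace DLProv

/-! ### Syntax of ELHI⊥ -/

/-- A role: a role name or an inverse role. Role names are natural numbers. -/
inductive DLRole : Type
  | name : ℕ → DLRole
  | inv : ℕ → DLRole
deriving DecidableEq

/-- The underlying role name of a role. -/
def DLRole.base : DLRole → ℕ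
  | .name R => R
  | .inv R => R

/-- The inverse of a role. -/
def DLRole.invr : DLRole → DLRole
  | .name R => .inv R
  | .inv R => .name R

/-- ELHI⊥ concepts (built from concept names, ⊤, ⊥, ⊓ and ∃P.C). -/
inductive DLConcept : Type
  | top : DLConcept
  | bot : DLConcept
  | atom : ℕ → DLConcept
  | inter : DLConcept → DLConcept → DLConcept
  | exis : DLRole → DLConcept → DLConcept
deriving DecidableEq

namespace DLConcept

/-- ELHI concepts: those not mentioning ⊥. -/
def botFree : DLConcept → Prop
  | top => True
  | bot => False
  | atom _ => True
  | inter C D => C.botFree ∧ D.botFree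
  | exis _ C => C.botFree

/-- Basic concepts: concept names and concepts of the form ∃P (= ∃P.⊤). -/
def isBasic (C : DLConcept) : Prop := (∃ A, C = atom A) ∨ ∃ P, C = exis P top

/-- Admissible right-hand sides of GCIs: ⊥, a concept name, or ∃P. -/
def isRHS (C : DLConcept) : Prop := C = bot ∨ (∃ A, C = atom A) ∨ ∃ P, C = exis P top

/-- A concept name or ⊤. -/
def isAtomic (C : DLConcept) : Prop := C = top ∨ ∃ A, C = atom A

/-- Concept names occurring in a concept. -/
def concNames : DLConcept → Finset ℕ
  | top => ∅
  | bot => ∅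
  | atom A => {A}
  | inter C D => C.concNames ∪ D.concNames
  | exis _ C => C.concNames

/-- Role names occurring in a concept. -/
def roleNames : DLConcept → Finset ℕ
  | top => ∅
  | bot => ∅
  | atom _ => ∅
  | inter C D => C.roleNames ∪ D.roleNames
  | exis P C => insert P.base C.roleNames

end DLConcept

/-- ELHI⊥ axioms: concept assertions A(a), role assertions R(a,b),
role inclusions P ⊑ Q, negative role inclusions P ⊓ Q ⊑ ⊥, and GCIs C ⊑ D. -/
inductive DLAxiom : Type
  | cassert : ℕ → ℕ → DLAxiom
  | rassert : ℕ → ℕ → ℕ → DLAxiom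
  | roleInc : DLRole → DLRole → DLAxiom
  | roleDisj : DLRole → DLRole → DLAxiom
  | gci : DLConcept → DLConcept → DLAxiom
deriving DecidableEq

namespace DLAxiom

/-- Well-formedness: the right-hand side of a GCI is ⊥, a concept name, or ∃P. -/
def wf : DLAxiom → Prop
  | gci _ D => D.isRHS
  | _ => True

def isAssertion : DLAxiom → Prop
  | cassert _ _ => True
  | rassert _ _ _ => True
  | _ => False

def concNames : DLAxiom → Finset ℕ
  | cassert A _ => {A}
  | rassert _ _ _ => ∅
  | roleInc _ _ => ∅
  | roleDisj _ _ => ∅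
  | gci C D => C.concNames ∪ D.concNames

def roleNames : DLAxiom → Finset ℕ
  | cassert _ _ => ∅
  | rassert R _ _ => {R}
  | roleInc P Q => {P.base, Q.base}
  | roleDisj P Q => {P.base, Q.base}
  | gci C D => C.roleNames ∪ D.roleNames

def indNames : DLAxiom → Finset ℕ
  | cassert _ a => {a}
  | rassert _ a b => {a, b}
  | _ => ∅

/-- ⊥ does not occur in the axiom. -/
def botFree : DLAxiom → Prop
  | cassert _ _ => True
  | rassert _ _ _ => True
  | roleInc _ _ => True
  | roleDisj _ _ => False
  | gci C D => C.botFree ∧ D.botFree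

/-- Normal form: every GCI is of one of the forms A₁ ⊓ A₂ ⊑ B, ∃P.A ⊑ B, or A ⊑ ∃P,
with A, A₁, A₂ ∈ N_C ∪ {⊤} and B ∈ N_C ∪ {⊥}. -/
def inNF : DLAxiom → Prop
  | gci C D =>
      (∃ C₁ C₂, C = .inter C₁ C₂ ∧ C₁.isAtomic ∧ C₂.isAtomic ∧ (D = .bot ∨ ∃ B, D = .atom B)) ∨
      (∃ P C', C = .exis P C' ∧ C'.isAtomic ∧ (D = .bot ∨ ∃ B, D = .atom B)) ∨
      (C.isAtomic ∧ ∃ P, D = .exis P .top)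
  | _ => True

end DLAxiom

/-! ### Annotated interpretations over a commutative semiring -/

/-- A 𝕂-annotated interpretation with domain `dom` inside the type `Δ`. -/
structure Interp (Δ : Type) (K : Type) where
  dom : Set Δ
  dom_nonempty : dom.Nonempty
  indiv : ℕ → Δ
  indiv_mem : ∀ a, indiv a ∈ dom
  conc : ℕ → Set (Δ × K)
  conc_mem : ∀ A p, p ∈ conc A → p.1 ∈ dom
  role : ℕ → Set (Δ × Δ × K)
  role_mem : ∀ R p, p ∈ role R → p.1 ∈ dom ∧ p.2.1 ∈ dom

variable {Δ Δ' K : Type}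

/-- Annotated extension of a role. -/
def DLRole.interp (I : Interp Δ K) : DLRole → Set (Δ × Δ × K)
  | .name R => I.role R
  | .inv R => {p | (p.2.1, p.1, p.2.2) ∈ I.role R}

/-- Annotated extension of a concept. -/
def DLConcept.interp [CommSemiring K] (I : Interp Δ K) : DLConcept → Set (Δ × K)
  | .top => {p | p.1 ∈ I.dom ∧ p.2 = 1}
  | .bot => ∅
  | .atom A => I.conc A
  | .inter C D => {p | ∃ d κ₁ κ₂, (d, κ₁) ∈ DLConcept.interp I C ∧
      (d, κ₂) ∈ DLConcept.interp I D ∧ p = (d, κ₁ * κ₂)}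
  | .exis P C => {p | ∃ d e κ₁ κ₂, (d, e, κ₁) ∈ DLRole.interp I P ∧
      (e, κ₂) ∈ DLConcept.interp I C ∧ p = (d, κ₁ * κ₂)}

/-- Satisfaction of an annotated axiom. -/
def Interp.satA [CommSemiring K] (I : Interp Δ K) : DLAxiom → K → Prop
  | .cassert A a, κ => (I.indiv a, κ) ∈ I.conc A
  | .rassert R a b, κ => (I.indiv a, I.indiv b, κ) ∈ I.role R
  | .roleInc P Q, κ => ∀ d e κ', (d, e, κ') ∈ P.interp I → (d, e, κ * κ') ∈ Q.interp I
  | .roleDisj P Q, _ => ∀ d e κ₁ κ₂, (d, e, κ₁) ∈ P.interp I → (d, e, κ₂) ∈ Q.interp I → False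
  | .gci C .bot, _ => C.interp I = ∅
  | .gci C D, κ => ∀ d κ', (d, κ') ∈ C.interp I → (d, κ * κ') ∈ D.interp I

/-! ### Conjunctive queries -/

inductive DLTerm : Type
  | var : ℕ → DLTerm
  | ind : ℕ → DLTerm
deriving DecidableEq

/-- Query atoms: A(t) with A ∈ N_C ∪ {⊤}, or R(t,t') with R ∈ N_R. -/
inductive QAtom : Type
  | top : DLTerm → QAtom
  | conc : ℕ → DLTerm → QAtom
  | role : ℕ → DLTerm → DLTerm → QAtom
deriving DecidableEq

/-- A (Boolean) conjunctive query: a conjunction of atoms, all variables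
existentially quantified. -/
abbrev BCQ := List QAtom

def Interp.tval (I : Interp Δ K) (π : ℕ → Δ) : DLTerm → Δ
  | .var v => π v
  | .ind a => I.indiv a

/-- A match of the extended version of an atom, assigning value `κ` to its
annotation variable. -/
def QAtom.holds [CommSemiring K] (I : Interp Δ K) (π : ℕ → Δ) : QAtom → K → Prop
  | .top t, κ => I.tval π t ∈ I.dom ∧ κ = 1
  | .conc A t, κ => (I.tval π t, κ) ∈ I.conc A
  | .role R t t', κ => (I.tval π t, I.tval π t', κ) ∈ I.role R

/-- `I` satisfies the annotated BCQ (q, κ): some match of the extended version of `q`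
gives κ as the product of the values of the annotation variables. -/
def Interp.satQ [CommSemiring K] (I : Interp Δ K) (q : BCQ) (κ : K) : Prop :=
  ∃ π : ℕ → Δ, (∀ v, π v ∈ I.dom) ∧
    ∃ κs : List K, List.Forall₂ (fun a k => QAtom.holds I π a k) q κs ∧ κs.prod = κ

/-- A statement: an axiom or a BCQ. -/
inductive DLStmt : Type
  | ax : DLAxiom → DLStmt
  | query : BCQ → DLStmt

def Interp.satS [CommSemiring K] (I : Interp Δ K) : DLStmt → K → Prop
  | .ax α, κ => I.satA α κ
  | .query q, κ => I.satQ q κ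

/-! ### Annotated ontologies, models and entailment -/

/-- The set of annotated axioms of the annotated ontology ⟨O, λ⟩. -/
def toAnn (O : Finset DLAxiom) (lam : DLAxiom → K) : Set (DLAxiom × K) :=
  {p | p.1 ∈ O ∧ p.2 = lam p.1}

def isModel [CommSemiring K] (I : Interp Δ K) (Ω : Set (DLAxiom × K)) : Prop :=
  ∀ p ∈ Ω, I.satA p.1 p.2

/-- Satisfiability of a set of annotated axioms. -/
def AnnSat [CommSemiring K] (Ω : Set (DLAxiom × K)) : Prop :=
  ∃ (Δ : Type) (I : Interp Δ K), isModel I Ω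

/-- Entailment of an annotated statement from a set of annotated axioms. -/
def Entails [CommSemiring K] (Ω : Set (DLAxiom × K)) (s : DLStmt) (κ : K) : Prop :=
  ∀ (Δ : Type) (I : Interp Δ K), isModel I Ω → I.satS s κ

/-! ### Non-annotated (plain) semantics -/

structure PInterp (Δ : Type) where
  dom : Set Δ
  dom_nonempty : dom.Nonempty
  indiv : ℕ → Δ
  indiv_mem : ∀ a, indiv a ∈ dom
  conc : ℕ → Set Δ
  conc_mem : ∀ A d, d ∈ conc A → d ∈ dom
  role : ℕ → Set (Δ × Δ)
  role_mem : ∀ R p, p ∈ role R → p.1 ∈ dom ∧ p.2 ∈ dom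

def DLRole.pinterp (I : PInterp Δ) : DLRole → Set (Δ × Δ)
  | .name R => I.role R
  | .inv R => {p | (p.2, p.1) ∈ I.role R}

def DLConcept.pinterp (I : PInterp Δ) : DLConcept → Set Δ
  | .top => I.dom
  | .bot => ∅
  | .atom A => I.conc A
  | .inter C D => DLConcept.pinterp I C ∩ DLConcept.pinterp I D
  | .exis P C => {d | ∃ e, (d, e) ∈ DLRole.pinterp I P ∧ e ∈ DLConcept.pinterp I C}

def PInterp.satA (I : PInterp Δ) : DLAxiom → Prop
  | .cassert A a => I.indiv a ∈ I.conc A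
  | .rassert R a b => (I.indiv a, I.indiv b) ∈ I.role R
  | .roleInc P Q => ∀ p ∈ P.pinterp I, p ∈ Q.pinterp I
  | .roleDisj P Q => ∀ p, p ∈ P.pinterp I → p ∈ Q.pinterp I → False
  | .gci C D => C.pinterp I ⊆ D.pinterp I

def PInterp.tval (I : PInterp Δ) (π : ℕ → Δ) : DLTerm → Δ
  | .var v => π v
  | .ind a => I.indiv a

def QAtom.pholds (I : PInterp Δ) (π : ℕ → Δ) : QAtom → Prop
  | .top t => I.tval π t ∈ I.dom
  | .conc A t => I.tval π t ∈ I.conc A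
  | .role R t t' => (I.tval π t, I.tval π t') ∈ I.role R

def PInterp.satQ (I : PInterp Δ) (q : BCQ) : Prop :=
  ∃ π : ℕ → Δ, (∀ v, π v ∈ I.dom) ∧ ∀ a ∈ q, QAtom.pholds I π a

def PInterp.satS (I : PInterp Δ) : DLStmt → Prop
  | .ax α => I.satA α
  | .query q => I.satQ q

def isPModel (I : PInterp Δ) (O : Finset DLAxiom) : Prop := ∀ α ∈ O, I.satA α

def PSat (O : Finset DLAxiom) : Prop := ∃ (Δ : Type) (I : PInterp Δ), isPModel I O

def PEntails (O : Finset DLAxiom) (s : DLStmt) : Prop :=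
  ∀ (Δ : Type) (I : PInterp Δ), isPModel I O → I.satS s

/-- A concept is satisfiable w.r.t. O if it has a nonempty extension in some model of O. -/
def CSat (O : Finset DLAxiom) (C : DLConcept) : Prop :=
  ∃ (Δ : Type) (I : PInterp Δ), isPModel I O ∧ (C.pinterp I).Nonempty

/-- A role is satisfiable w.r.t. O if it has a nonempty extension in some model of O. -/
def RSat (O : Finset DLAxiom) (P : DLRole) : Prop :=
  ∃ (Δ : Type) (I : PInterp Δ), isPModel I O ∧ (P.pinterp I).Nonempty

/-- The plain interpretation obtained from an annotated one by dropping annotations. -/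
def Interp.forget (I : Interp Δ K) : PInterp Δ where
  dom := I.dom
  dom_nonempty := I.dom_nonempty
  indiv := I.indiv
  indiv_mem := I.indiv_mem
  conc A := {d | ∃ κ, (d, κ) ∈ I.conc A}
  conc_mem := fun A d hd => by obtain ⟨κ, hκ⟩ := hd; exact I.conc_mem A _ hκ
  role R := {p | ∃ κ, (p.1, p.2, κ) ∈ I.role R}
  role_mem := fun R p hp => by obtain ⟨κ, hκ⟩ := hp; exact I.role_mem R _ hκ

/-! ### ω-continuous commutative semirings and provenance -/

/-- The canonical preorder of a semiring: a ≤ b iff a ⊕ c = b for some c. -/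
def canLE [Add K] (a b : K) : Prop := ∃ c, a + c = b

/-- The set of all sums of finite subsets of `S`. -/
def finSubsums [AddCommMonoid K] (S : Set K) : Set K :=
  {x | ∃ F : Finset K, ↑F ⊆ S ∧ F.sum id = x}

/-- `u` is a least upper bound of `S` w.r.t. the canonical preorder. -/
def IsSupOf [Add K] (S : Set K) (u : K) : Prop :=
  (∀ a ∈ S, canLE a u) ∧ ∀ v, (∀ a ∈ S, canLE a v) → canLE u v

/-- ω-continuous commutative semirings: the canonical preorder is a partial order,
ω-chains have least upper bounds preserved by ⊕ and ⊗, and possibly infinite sums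
are defined as suprema of finite subsums. -/
class OmegaCS (K : Type) extends CommSemiring K where
  canLE_antisymm : ∀ a b : K, canLE a b → canLE b a → a = b
  csup : (ℕ → K) → K
  csup_isSup : ∀ f : ℕ → K, (∀ n, canLE (f n) (f (n + 1))) → IsSupOf (Set.range f) (csup f)
  add_csup : ∀ f : ℕ → K, (∀ n, canLE (f n) (f (n + 1))) →
      ∀ a : K, a + csup f = csup fun n => a + f n
  mul_csup : ∀ f : ℕ → K, (∀ n, canLE (f n) (f (n + 1))) →
      ∀ a : K, a * csup f = csup fun n => a * f n
  setSum : Set K → K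
  setSum_isSup : ∀ S : Set K, IsSupOf (finSubsums S) (setSum S)

/-- The provenance of a statement w.r.t. a set of annotated axioms: the (possibly
infinite) sum of all κ such that (s, κ) is entailed. -/
def prov [OmegaCS K] (Ω : Set (DLAxiom × K)) (s : DLStmt) : K :=
  OmegaCS.setSum {κ | Entails Ω s κ}

/-! ### Instance queries -/

/-- `qCt C t n` is the (body of) the instance query for the concept `C` with head
term `t`, using fresh variables starting from `n`; returns the query together with
the next fresh variable index. -/
def qCt : DLConcept → DLTerm → ℕ → BCQ × ℕ
  | .top, t, n => ([QAtom.top t], n)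
  | .bot, t, n => ([QAtom.top t], n)
  | .atom A, t, n => ([QAtom.conc A t], n)
  | .inter C D, t, n =>
      let r₁ := qCt C t n
      let r₂ := qCt D t r₁.2
      (r₁.1 ++ r₂.1, r₂.2)
  | .exis (.name R) C, t, n =>
      let r := qCt C (.var n) (n + 1)
      (QAtom.role R t (.var n) :: r.1, r.2)
  | .exis (.inv R) C, t, n =>
      let r := qCt C (.var n) (n + 1)
      (QAtom.role R (.var n) t :: r.1, r.2)

/-- The instance query q_C(a) for an individual name a. -/
def qCa (C : DLConcept) (a : ℕ) : BCQ := (qCt C (DLTerm.ind a) 0).1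

/-! ### Database matches -/

def tvalN (σ : ℕ → ℕ) : DLTerm → ℕ
  | .var v => σ v
  | .ind a => a

def QAtom.dbHolds (O : Finset DLAxiom) (σ : ℕ → ℕ) : QAtom → Prop
  | .top _ => True
  | .conc A t => DLAxiom.cassert A (tvalN σ t) ∈ O
  | .role R t t' => DLAxiom.rassert R (tvalN σ t) (tvalN σ t') ∈ O

/-- A database match of a BCQ in a set of assertions. -/
def isDBMatch (O : Finset DLAxiom) (σ : ℕ → ℕ) (q : BCQ) : Prop :=
  ∀ a ∈ q, QAtom.dbHolds O σ a

def QAtom.dbVal [CommSemiring K] (lam : DLAxiom → K) (σ : ℕ → ℕ) : QAtom → K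
  | .top _ => 1
  | .conc A t => lam (DLAxiom.cassert A (tvalN σ t))
  | .role R t t' => lam (DLAxiom.rassert R (tvalN σ t) (tvalN σ t'))

/-- The ⊗-product, over the atoms of `q`, of the annotations of the matched facts. -/
def matchVal [CommSemiring K] (lam : DLAxiom → K) (σ : ℕ → ℕ) (q : BCQ) : K :=
  (q.map (QAtom.dbVal lam σ)).prod

/-! ### Homomorphisms and canonical models -/

/-- Homomorphism between 𝕂-annotated interpretations. -/
def IsHom [CommSemiring K] (Ic : Interp Δ K) (I : Interp Δ' K) (g : Δ → Δ') : Prop :=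
  Set.MapsTo g Ic.dom I.dom ∧ (∀ a, g (Ic.indiv a) = I.indiv a) ∧
  (∀ A d κ, (d, κ) ∈ Ic.conc A → (g d, κ) ∈ I.conc A) ∧
  (∀ R d e κ, (d, e, κ) ∈ Ic.role R → (g d, g e, κ) ∈ I.role R)

/-- Domain of canonical models: individual names (inl) plus fresh elements (inr). -/
abbrev CD : Type := ℕ ⊕ ℕ

def baseConc (Ω : Set (DLAxiom × K)) (A : ℕ) : Set (CD × K) :=
  {p | ∃ a κ, (DLAxiom.cassert A a, κ) ∈ Ω ∧ p = (Sum.inl a, κ)}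

def baseRole (Ω : Set (DLAxiom × K)) (R : ℕ) : Set (CD × CD × K) :=
  {p | ∃ a b κ, (DLAxiom.rassert R a b, κ) ∈ Ω ∧ p = (Sum.inl a, Sum.inl b, κ)}

/-- The initial interpretation I₀ of the canonical model construction. -/
def InitCan (Ω : Set (DLAxiom × K)) (I : Interp CD K) : Prop :=
  I.dom = Set.range (Sum.inl : ℕ → CD) ∧ I.indiv = Sum.inl ∧
  (∀ A, I.conc A = baseConc Ω A) ∧ (∀ R, I.role R = baseRole Ω R)

/-- Where and how a tuple is inserted for the role `P`: the underlying role name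
and the (suitably oriented) tuple. -/
def insRole (P : DLRole) (d e : CD) (κ : K) : ℕ × (CD × CD × K) :=
  match P with
  | .name R => (R, (d, e, κ))
  | .inv R => (R, (e, d, κ))

/-- One application of a rule of the canonical model construction. -/
def StepCan [CommSemiring K] (Ω : Set (DLAxiom × K)) (I J : Interp CD K) : Prop :=
  (∃ P Q κ d e κ', (DLAxiom.roleInc P Q, κ) ∈ Ω ∧ (d, e, κ') ∈ DLRole.interp I P ∧
     J.dom = I.dom ∧ J.indiv = I.indiv ∧ (∀ A, J.conc A = I.conc A) ∧
     (∀ S, S ≠ (insRole Q d e (κ * κ')).1 → J.role S = I.role S) ∧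
     J.role (insRole Q d e (κ * κ')).1 =
       insert (insRole Q d e (κ * κ')).2 (I.role (insRole Q d e (κ * κ')).1)) ∨
  (∃ C A κ d κ', (DLAxiom.gci C (DLConcept.atom A), κ) ∈ Ω ∧ (d, κ') ∈ DLConcept.interp I C ∧
     J.dom = I.dom ∧ J.indiv = I.indiv ∧ (∀ R, J.role R = I.role R) ∧
     (∀ B, B ≠ A → J.conc B = I.conc B) ∧ J.conc A = insert (d, κ * κ') (I.conc A)) ∨
  (∃ C P κ d κ' df, (DLAxiom.gci C (DLConcept.exis P DLConcept.top), κ) ∈ Ω ∧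
     (d, κ') ∈ DLConcept.interp I C ∧ df ∉ I.dom ∧
     J.dom = insert df I.dom ∧ J.indiv = I.indiv ∧ (∀ A, J.conc A = I.conc A) ∧
     (∀ S, S ≠ (insRole P d df (κ * κ')).1 → J.role S = I.role S) ∧
     J.role (insRole P d df (κ * κ')).1 =
       insert (insRole P d df (κ * κ')).2 (I.role (insRole P d df (κ * κ')).1))

/-- Fairness: every applicable rule instance has eventually been applied,
i.e. the limit is closed under the rules. -/
def ClosedCan [CommSemiring K] (Ω : Set (DLAxiom × K)) (I : Interp CD K) : Prop :=
  (∀ P Q κ, (DLAxiom.roleInc P Q, κ) ∈ Ω →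
      ∀ d e κ', (d, e, κ') ∈ DLRole.interp I P → (d, e, κ * κ') ∈ DLRole.interp I Q) ∧
  (∀ C A κ, (DLAxiom.gci C (DLConcept.atom A), κ) ∈ Ω →
      ∀ d κ', (d, κ') ∈ DLConcept.interp I C → (d, κ * κ') ∈ I.conc A) ∧
  (∀ C P κ, (DLAxiom.gci C (DLConcept.exis P DLConcept.top), κ) ∈ Ω →
      ∀ d κ', (d, κ') ∈ DLConcept.interp I C → ∃ e, (d, e, κ * κ') ∈ DLRole.interp I P)

/-- `I` is the union of the increasing sequence `Iseq`. -/
def IsLimitOf (Iseq : ℕ → Interp CD K) (I : Interp CD K) : Prop :=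
  I.dom = (⋃ n, (Iseq n).dom) ∧ I.indiv = (Iseq 0).indiv ∧
  (∀ A, I.conc A = ⋃ n, (Iseq n).conc A) ∧ (∀ R, I.role R = ⋃ n, (Iseq n).role R)

/-- `I` is a canonical model of the annotated ontology `Ω`. -/
def IsCanMod [CommSemiring K] (Ω : Set (DLAxiom × K)) (I : Interp CD K) : Prop :=
  ∃ Iseq : ℕ → Interp CD K, InitCan Ω (Iseq 0) ∧
    (∀ n, Iseq (n + 1) = Iseq n ∨ StepCan Ω (Iseq n) (Iseq (n + 1))) ∧
    IsLimitOf Iseq I ∧ ClosedCan Ω I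

/-- The initial interpretation of the canonical model construction for a basic
concept `C` annotated with `κ`, with distinguished fresh element `dC`. -/
def InitCanC [CommSemiring K] (Ω : Set (DLAxiom × K)) (C : DLConcept) (κ : K)
    (dC : CD) (I : Interp CD K) : Prop :=
  I.indiv = Sum.inl ∧ dC ∉ Set.range (Sum.inl : ℕ → CD) ∧
  match C with
  | .atom A =>
      I.dom = insert dC (Set.range (Sum.inl : ℕ → CD)) ∧
      (∀ B, B ≠ A → I.conc B = baseConc Ω B) ∧
      I.conc A = insert (dC, κ) (baseConc Ω A) ∧
      (∀ R, I.role R = baseRole Ω R)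
  | .exis P .top =>
      ∃ df, df ∉ Set.range (Sum.inl : ℕ → CD) ∧ df ≠ dC ∧
        I.dom = insert dC (insert df (Set.range (Sum.inl : ℕ → CD))) ∧
        (∀ B, I.conc B = baseConc Ω B) ∧
        (∀ S, S ≠ (insRole P dC df κ).1 → I.role S = baseRole Ω S) ∧
        I.role (insRole P dC df κ).1 =
          insert (insRole P dC df κ).2 (baseRole Ω (insRole P dC df κ).1)
  | _ => False

/-- `I` is a canonical model of the basic concept `C`, annotation `κ` and `Ω`. -/
def IsCanModC [CommSemiring K] (Ω : Set (DLAxiom × K)) (C : DLConcept) (κ : K)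
    (dC : CD) (I : Interp CD K) : Prop :=
  ∃ Iseq : ℕ → Interp CD K, InitCanC Ω C κ dC (Iseq 0) ∧
    (∀ n, Iseq (n + 1) = Iseq n ∨ StepCan Ω (Iseq n) (Iseq (n + 1))) ∧
    IsLimitOf Iseq I ∧ ClosedCan Ω I


/-- The interpretation of a role depends only on the interpretation of role names. -/
theorem DLRole.interp_congr {I J : Interp Δ K} (hrole : J.role = I.role) (P : DLRole) :
    P.interp J = P.interp I := by
  cases P <;> simp [DLRole.interp, hrole]

/-- The interpretation of a concept depends only on the concept names occurring in it. -/
theorem DLConcept.interp_congr [CommSemiring K] {I J : Interp Δ K} (hdom : J.dom = I.dom)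
    (hrole : J.role = I.role) (C : DLConcept) (hconc : ∀ A ∈ C.concNames, J.conc A = I.conc A) :
    C.interp J = C.interp I := by
  induction C with
  | top => simp [DLConcept.interp, hdom]
  | bot => rfl
  | atom A => exact hconc A (by simp [DLConcept.concNames])
  | inter C D ihC ihD =>
    simp only [DLConcept.concNames, Finset.mem_union] at hconc
    simp only [DLConcept.interp, ihC fun A hA => hconc A (.inl hA),
      ihD fun A hA => hconc A (.inr hA)]
  | exis P C ih =>
    simp only [DLConcept.interp, ih hconc, DLRole.interp_congr hrole]

/-- Satisfaction of an axiom depends only on the concept names occurring in it. -/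
theorem Interp.satA_congr [CommSemiring K] {I J : Interp Δ K} (hdom : J.dom = I.dom)
    (hind : J.indiv = I.indiv) (hrole : J.role = I.role) (α : DLAxiom)
    (hconc : ∀ A ∈ α.concNames, J.conc A = I.conc A) (κ : K) :
    J.satA α κ ↔ I.satA α κ := by
  cases α with
  | cassert A a => simp [Interp.satA, hind, hconc A (by simp [DLAxiom.concNames])]
  | rassert R a b => simp [Interp.satA, hind, hrole]
  | roleInc P Q => simp only [Interp.satA, DLRole.interp_congr hrole]
  | roleDisj P Q => simp only [Interp.satA, DLRole.interp_congr hrole]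
  | gci C D =>
    simp only [DLAxiom.concNames, Finset.mem_union] at hconc
    have hC := DLConcept.interp_congr hdom hrole C fun A hA => hconc A (.inl hA)
    have hD := DLConcept.interp_congr hdom hrole D fun A hA => hconc A (.inr hA)
    cases D <;> simp only [Interp.satA, hC, hD]

theorem DLRole.interp_mem_dom {I : Interp Δ K} {P : DLRole} {d e : Δ} {κ : K}
    (h : (d, e, κ) ∈ P.interp I) : d ∈ I.dom ∧ e ∈ I.dom := by
  cases P with
  | name R => exact I.role_mem R _ h
  | inv R => exact (I.role_mem R _ h).symm

theorem DLConcept.interp_mem_dom [CommSemiring K] {I : Interp Δ K} (C : DLConcept) :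
    ∀ p ∈ C.interp I, p.1 ∈ I.dom := by
  induction C with
  | top => exact fun p hp => hp.1
  | bot => exact fun p hp => hp.elim
  | atom A => exact I.conc_mem A
  | inter C D ihC _ =>
    rintro _ ⟨d, κ₁, κ₂, h₁, -, rfl⟩
    exact ihC (d, κ₁) h₁
  | exis P C _ =>
    rintro _ ⟨d, e, κ₁, κ₂, h₁, -, rfl⟩
    exact (DLRole.interp_mem_dom h₁).1

/-- Reinterpret one concept name by a given annotated set. -/
def Interp.updateConc (I : Interp Δ K) (A : ℕ) (S : Set (Δ × K)) (hS : ∀ p ∈ S, p.1 ∈ I.dom) :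
    Interp Δ K where
  dom := I.dom
  dom_nonempty := I.dom_nonempty
  indiv := I.indiv
  indiv_mem := I.indiv_mem
  conc := Function.update I.conc A S
  conc_mem B p hp := by
    rcases eq_or_ne B A with rfl | hB
    · exact hS p (by simpa using hp)
    · exact I.conc_mem B p (by simpa [hB] using hp)
  role := I.role
  role_mem := I.role_mem

/-- A match of the extended query yields membership in the extension of the concept. -/
theorem mem_interp_of_match [CommSemiring K] (I : Interp Δ K) (π : ℕ → Δ) (C : DLConcept)
    (hC : C.botFree) (t : DLTerm) (n : ℕ) (κs : List K)
    (h : List.Forall₂ (fun a k => QAtom.holds I π a k) (qCt C t n).1 κs) :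
    (I.tval π t, κs.prod) ∈ C.interp I := by
  induction C generalizing t n κs with
  | top =>
    obtain ⟨k, l, hk, hl, rfl⟩ := List.forall₂_cons_left_iff.1 h
    obtain rfl := List.forall₂_nil_left_iff.1 hl
    simpa [QAtom.holds, DLConcept.interp] using hk
  | bot => exact hC.elim
  | atom A =>
    obtain ⟨k, l, hk, hl, rfl⟩ := List.forall₂_cons_left_iff.1 h
    obtain rfl := List.forall₂_nil_left_iff.1 hl
    simpa [QAtom.holds, DLConcept.interp] using hk
  | inter C D ihC ihD =>
    have h₁ := List.forall₂_take_append κs _ _ h.flip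
    have h₂ := List.forall₂_drop_append κs _ _ h.flip
    refine ⟨_, _, _, ihC hC.1 t n _ h₁.flip, ihD hC.2 t _ _ h₂.flip, ?_⟩
    rw [List.prod_take_mul_prod_drop]
  | exis P C ih =>
    cases P <;>
    · obtain ⟨k, l, hk, hl, rfl⟩ := List.forall₂_cons_left_iff.1 h
      exact ⟨I.tval π t, π n, k, l.prod, hk, ih hC _ _ _ hl, by rw [List.prod_cons]⟩

/-- Evaluation of a term depends only on the variables occurring in it. -/
theorem Interp.tval_congr {I : Interp Δ K} {π π' : ℕ → Δ} {n : ℕ} {t : DLTerm}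
    (ht : ∀ v, t = .var v → v < n) (h : ∀ v < n, π' v = π v) : I.tval π' t = I.tval π t := by
  cases t with
  | var v => exact h v (ht v rfl)
  | ind a => rfl

theorem le_qCt_snd (C : DLConcept) (t : DLTerm) (n : ℕ) : n ≤ (qCt C t n).2 := by
  induction C generalizing t n with
  | top => exact le_rfl
  | bot => exact le_rfl
  | atom A => exact le_rfl
  | inter C D ihC ihD => exact (ihC t n).trans (ihD t _)
  | exis P C ih => cases P <;> exact (Nat.le_succ n).trans (ih _ _)

/-- Membership in the extension of a concept yields a match of its instance query, extending a
given assignment of the variables below `n` and robust under changes of the variables not yet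
in use. -/
theorem exists_match_of_mem_interp [CommSemiring K] (I : Interp Δ K) (C : DLConcept)
    (t : DLTerm) (n : ℕ) (π : ℕ → Δ) (κ : K) (hπ : ∀ v, π v ∈ I.dom)
    (ht : ∀ v, t = .var v → v < n) (h : (I.tval π t, κ) ∈ C.interp I) :
    ∃ π' : ℕ → Δ, (∀ v, π' v ∈ I.dom) ∧ (∀ v < n, π' v = π v) ∧
      ∃ κs : List K, κs.prod = κ ∧ ∀ ρ : ℕ → Δ, (∀ v < (qCt C t n).2, ρ v = π' v) →
        List.Forall₂ (fun a k => QAtom.holds I ρ a k) (qCt C t n).1 κs := by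
  induction C generalizing t n π κ with
  | top =>
    refine ⟨π, hπ, fun _ _ => rfl, [κ], by simp, fun ρ hρ => .cons ?_ .nil⟩
    have := Interp.tval_congr (I := I) ht hρ
    simpa [QAtom.holds, this, DLConcept.interp] using h
  | bot => exact h.elim
  | atom A =>
    refine ⟨π, hπ, fun _ _ => rfl, [κ], by simp, fun ρ hρ => .cons ?_ .nil⟩
    have := Interp.tval_congr (I := I) ht hρ
    simpa [QAtom.holds, this, DLConcept.interp] using h
  | inter C D ihC ihD =>
    obtain ⟨d, κ₁, κ₂, h₁, h₂, heq⟩ := h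
    obtain ⟨rfl, rfl⟩ := Prod.mk.inj heq
    obtain ⟨π₁, hπ₁, hag₁, l₁, hl₁, hm₁⟩ := ihC t n π κ₁ hπ ht h₁
    have hn := le_qCt_snd C t n
    obtain ⟨π₂, hπ₂, hag₂, l₂, hl₂, hm₂⟩ := ihD t (qCt C t n).2 π₁ κ₂ hπ₁
      (fun v hv => (ht v hv).trans_le hn) (by rwa [Interp.tval_congr ht hag₁])
    refine ⟨π₂, hπ₂, fun v hv => (hag₂ v (hv.trans_le hn)).trans (hag₁ v hv), l₁ ++ l₂,
      by rw [List.prod_append, hl₁, hl₂], fun ρ hρ => List.rel_append (hm₁ ρ fun v hv => ?_)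
        (hm₂ ρ hρ)⟩
    exact (hρ v (hv.trans_le (le_qCt_snd D t _))).trans (hag₂ v hv)
  | exis P C ih =>
    obtain ⟨d, e, κ₁, κ₂, h₁, h₂, heq⟩ := h
    obtain ⟨rfl, rfl⟩ := Prod.mk.inj heq
    have hag : ∀ v < n, Function.update π n e v = π v := fun v hv =>
      Function.update_of_ne hv.ne _ _
    obtain ⟨π', hπ', hag', l, hl, hm⟩ := ih (.var n) (n + 1) (Function.update π n e) κ₂
      (fun v => by
        rcases eq_or_ne v n with rfl | hv
        · simpa using (DLRole.interp_mem_dom h₁).2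
        · simpa [hv] using hπ v)
      (fun v hv => by cases hv; exact n.lt_succ_self)
      (by simpa [Interp.tval] using h₂)
    have hn := le_qCt_snd C (.var n) (n + 1)
    have hagn : ∀ v < n, π' v = π v := fun v hv =>
      (hag' v (hv.trans n.lt_succ_self)).trans (hag v hv)
    refine ⟨π', hπ', hagn, κ₁ :: l, by rw [List.prod_cons, hl], fun ρ hρ => ?_⟩
    have hρ' : ∀ v < (qCt C (.var n) (n + 1)).2, ρ v = π' v := by cases P <;> exact hρ
    have hte : I.tval ρ t = I.tval π t := Interp.tval_congr ht fun v hv =>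
      (hρ' v (hv.trans (n.lt_succ_self.trans_le hn))).trans (hagn v hv)
    have hne : I.tval ρ (.var n) = e := by
      simp [Interp.tval, hρ' n (n.lt_succ_self.trans_le hn), hag' n n.lt_succ_self]
    cases P <;>
    · refine .cons ?_ (hm ρ hρ')
      simpa [QAtom.holds, hte, hne, DLRole.interp] using h₁

/-- The instance query of an ELHI concept captures its annotated extension. -/
theorem Interp.satQ_qCa_iff [CommSemiring K] (I : Interp Δ K) (C : DLConcept) (hC : C.botFree)
    (a : ℕ) (κ : K) : I.satQ (qCa C a) κ ↔ (I.indiv a, κ) ∈ C.interp I := by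
  constructor
  · rintro ⟨π, -, κs, hm, rfl⟩
    exact mem_interp_of_match I π C hC (.ind a) 0 κs hm
  · intro h
    obtain ⟨π, hπ, -, κs, hκ, hm⟩ := exists_match_of_mem_interp I C (.ind a) 0
      (fun _ => I.indiv a) κ (fun _ => I.indiv_mem a) (fun v hv => by cases hv) h
    exact ⟨π, hπ, κs, hm π fun _ _ => rfl, hκ⟩

/-- For an ω-continuous commutative semiring 𝕂, an ELHI concept C,
an individual a and a fresh concept name A_C occurring neither in O nor in C:
P(A_C(a), O ∪ {(C ⊑ A_C, 1)}) = P(q_C(a), O). -/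
theorem statement2 {K : Type} [OmegaCS K]
    (O : Finset DLAxiom) (lam : DLAxiom → K)
    (hwf : ∀ α ∈ O, α.wf) (hnz : ∀ α ∈ O, lam α ≠ 0)
    (C : DLConcept) (hC : C.botFree) (a : ℕ) (AC : ℕ)
    (hACO : ∀ α ∈ O, AC ∉ α.concNames) (hACC : AC ∉ C.concNames) :
    prov (insert (DLAxiom.gci C (DLConcept.atom AC), (1 : K)) (toAnn O lam))
        (DLStmt.ax (DLAxiom.cassert AC a)) =
      prov (toAnn O lam) (DLStmt.query (qCa C a)) := by
  unfold prov
  congr 1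
  ext κ
  constructor
  · intro h Δ I hI
    let J := I.updateConc AC (C.interp I) C.interp_mem_dom
    have hconc : ∀ B, B ≠ AC → J.conc B = I.conc B := fun B hB => Function.update_of_ne hB _ _
    have hAC : J.conc AC = C.interp I := Function.update_self _ _ _
    have hCJ : C.interp J = C.interp I :=
      DLConcept.interp_congr (I := I) (J := J) rfl rfl C fun B hB =>
        hconc B (ne_of_mem_of_not_mem hB hACC)
    have hJ : isModel J (insert (DLAxiom.gci C (DLConcept.atom AC), (1 : K)) (toAnn O lam)) := by
      rintro p (rfl | hp)
      · intro d κ' hd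
        rw [one_mul]
        change (d, κ') ∈ J.conc AC
        rw [hAC, ← hCJ]
        exact hd
      · exact (Interp.satA_congr (I := I) (J := J) rfl rfl rfl p.1 (fun B hB =>
          hconc B (ne_of_mem_of_not_mem hB (hACO _ hp.1))) p.2).2 (hI p hp)
    have hmem : (I.indiv a, κ) ∈ J.conc AC := h Δ J hJ
    exact (I.satQ_qCa_iff C hC a κ).2 (hAC ▸ hmem)
  · intro h Δ I hI
    have hmem := (I.satQ_qCa_iff C hC a κ).1 (h Δ I fun p hp => hI p (.inr hp))
    have hgci := hI _ (.inl rfl) (I.indiv a) κ hmem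
    rwa [one_mul] at hgci

end DLProv
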